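/- The presented groups <X, Y | X Y^{-1} X^{-3} Y X^3 Y X^{-3} Y^{-1} X^2 Y^{-1} X^{-3} Y X^3 Y X^{-3} Y^{-1} X^4> and <X, Y | X^4 Y^{-1} X^{-3} Y X^4 Y X^{-3} Y^{-1} X Y^{-1} X^{-3} Y X^4 Y X^{-3} Y^{-1}> are isomorphic, an isomorphism being induced by the automorphism of the free group sending Y to X Y and X to X (followed by free reduction and a cyclic permutation of the relator). (These are the two presentations (4.2) and (6.1) of the fundamental group of the complement of the knot D_+(T_{2,3}, 6), the 6-twisted positive Whitehead double of the right-handed trefoil: the first comes from a genus-one doubly-pointed Heegaard diagram, while the second is pseudo-geometric but does not come from such a diagram.) -/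

import Mathlib

/-- The free group on two generators `X` and `Y`. -/
abbrev F2 := FreeGroup (Fin 2)

/-- The generator `X`. -/
def X : F2 := FreeGroup.of 0

/-- The generator `Y`. -/
def Y : F2 := FreeGroup.of 1

/-- The relator `X Y⁻¹ X⁻³ Y X³ Y X⁻³ Y⁻¹ X² Y⁻¹ X⁻³ Y X³ Y X⁻³ Y⁻¹ X⁴`
(presentation (4.2) of `π₁(S³ ∖ D₊(T₂,₃, 6))`). -/
def r1 : F2 :=
  X * Y⁻¹ * X ^ (-3 : ℤ) * Y * X ^ 3 * Y * X ^ (-3 : ℤ) * Y⁻¹ * X ^ 2 *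
    Y⁻¹ * X ^ (-3 : ℤ) * Y * X ^ 3 * Y * X ^ (-3 : ℤ) * Y⁻¹ * X ^ 4

/-- The relator `X⁴ Y⁻¹ X⁻³ Y X⁴ Y X⁻³ Y⁻¹ X Y⁻¹ X⁻³ Y X⁴ Y X⁻³ Y⁻¹`
(presentation (6.1) of `π₁(S³ ∖ D₊(T₂,₃, 6))`). -/
def r2 : F2 :=
  X ^ 4 * Y⁻¹ * X ^ (-3 : ℤ) * Y * X ^ 4 * Y * X ^ (-3 : ℤ) * Y⁻¹ * X *
    Y⁻¹ * X ^ (-3 : ℤ) * Y * X ^ 4 * Y * X ^ (-3 : ℤ) * Y⁻¹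

/-- Conjugate elements have the same normal closure. -/
theorem normalClosure_singleton_eq_of_isConj {G : Type*} [Group G] {a b : G} (h : IsConj a b) :
    Subgroup.normalClosure {a} = Subgroup.normalClosure {b} := by
  simp only [Subgroup.normalClosure, Group.conjugatesOfSet, Set.biUnion_singleton,
    h.conjugatesOf_eq]

/-- The automorphism of the free group fixing `X` and sending `Y` to `X * Y`. -/
def transvection : F2 ≃* F2 :=
  MonoidHom.toMulEquiv (FreeGroup.lift ![X, X * Y]) (FreeGroup.lift ![X, X⁻¹ * Y])
    (by ext i; fin_cases i <;> simp [X, Y])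
    (by ext i; fin_cases i <;> simp [X, Y])

theorem transvection_X : transvection X = X := by
  simp [transvection, X]

theorem transvection_Y : transvection Y = X * Y := by
  simp [transvection, Y]

theorem transvection_r1 : transvection r1 = X ^ (-3 : ℤ) * r2 * (X ^ (-3 : ℤ))⁻¹ := by
  simp only [r1, r2, map_mul, map_inv, map_pow, map_zpow, transvection_X, transvection_Y]
  group

theorem map_transvection_normalClosure :
    (Subgroup.normalClosure {r1}).map (transvection : F2 →* F2) =
      Subgroup.normalClosure {r2} := by
  rw [Subgroup.map_normalClosure _ (transvection : F2 →* F2) transvection.surjective,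
    Set.image_singleton]
  exact (normalClosure_singleton_eq_of_isConj
    (isConj_iff.2 ⟨X ^ (-3 : ℤ), transvection_r1.symm⟩)).symm

/-- the two presented groups above (two presentations of the
fundamental group of the complement of the 6-twisted positive Whitehead double of
the right-handed trefoil) are isomorphic via the automorphism of the free group
sending `Y ↦ X Y`, `X ↦ X`. -/
theorem whitehead_double_presentations_isomorphic :
    ∃ φ : PresentedGroup ({r1} : Set F2) ≃* PresentedGroup ({r2} : Set F2),
      φ (PresentedGroup.of 0) = PresentedGroup.of (rels := ({r2} : Set F2)) 0 ∧
      φ (PresentedGroup.of 1) =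
        PresentedGroup.of (rels := ({r2} : Set F2)) 0 *
          PresentedGroup.of (rels := ({r2} : Set F2)) 1 := by
  refine ⟨QuotientGroup.congr _ _ transvection map_transvection_normalClosure, ?_, ?_⟩
  · exact congrArg (PresentedGroup.mk {r2}) transvection_X
  · exact congrArg (PresentedGroup.mk {r2}) transvection_Y
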